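/- Fix N ≥ 2. Let R̃ = ℂ[X_1,…,X_m,B_1,…,B_N] be graded with each X_i homogeneous of positive integer degree and B_k homogeneous of degree 2k, let I_B be the ideal generated by B_1,…,B_N, and set R := R̃/I_B ≅ ℂ[X_1,…,X_m]. Let w ∈ R̃ be homogeneous of degree 2N+2 and let M̃ be a graded matrix factorization over R̃ with potential w whose total grading is bounded below. Then M̃ is null-homotopic over R̃ (i.e., the identity morphism of M̃ is homotopic to the zero morphism) if and only if M̃/I_B M̃ is null-homotopic as a matrix factorization over R. -/

import Mathlib

/-!
Statement 14: Let `R̃ = ℂ[X_1,…,X_m,B_1,…,B_N]` with `X_i` homogeneous of positive degree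
and `B_k` of degree `2k`, `I_B = (B_1,…,B_N)`, `R = R̃/I_B ≅ ℂ[X_1,…,X_m]`, and let `w ∈ R̃`
be homogeneous of degree `2N+2`.  If `M̃` is a graded matrix factorization over `R̃` with
potential `w` whose grading is bounded below, then `M̃` is null-homotopic over `R̃`
(the identity is homotopic to zero) iff `M̃/I_B M̃` is null-homotopic over `R`.

Graded free modules are modeled as `ι →₀ R̃` with a degree function on the basis `ι`; a
linear map is homogeneous of degree `c` when all of its matrix entries are weighted
homogeneous of the appropriate degrees.
-/

open MvPolynomial

section MFdefs

variable {S : Type*} [CommRing S] {A0 A1 B0 B1 : Type*}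
  [AddCommGroup A0] [AddCommGroup A1] [AddCommGroup B0] [AddCommGroup B1]
  [Module S A0] [Module S A1] [Module S B0] [Module S B1]

/-- `(f0, f1)` is a morphism of matrix factorizations from `(dA0, dA1)` to `(dB0, dB1)`. -/
def IsMFMorphism (dA0 : A0 →ₗ[S] A1) (dA1 : A1 →ₗ[S] A0)
    (dB0 : B0 →ₗ[S] B1) (dB1 : B1 →ₗ[S] B0)
    (f0 : A0 →ₗ[S] B0) (f1 : A1 →ₗ[S] B1) : Prop :=
  f1.comp dA0 = dB0.comp f0 ∧ f0.comp dA1 = dB1.comp f1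

/-- The morphisms `(f0, f1)` and `(g0, g1)` of matrix factorizations are homotopic. -/
def MFHomotopic (dA0 : A0 →ₗ[S] A1) (dA1 : A1 →ₗ[S] A0)
    (dB0 : B0 →ₗ[S] B1) (dB1 : B1 →ₗ[S] B0)
    (f0 g0 : A0 →ₗ[S] B0) (f1 g1 : A1 →ₗ[S] B1) : Prop :=
  ∃ (h0 : A0 →ₗ[S] B1) (h1 : A1 →ₗ[S] B0),
    f0 - g0 = dB1.comp h0 + h1.comp dA0 ∧ f1 - g1 = dB0.comp h1 + h0.comp dA1

/-- The morphism `(f0, f1)` of matrix factorizations is a homotopy equivalence. -/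
def IsMFHomotopyEquiv (dA0 : A0 →ₗ[S] A1) (dA1 : A1 →ₗ[S] A0)
    (dB0 : B0 →ₗ[S] B1) (dB1 : B1 →ₗ[S] B0)
    (f0 : A0 →ₗ[S] B0) (f1 : A1 →ₗ[S] B1) : Prop :=
  ∃ (g0 : B0 →ₗ[S] A0) (g1 : B1 →ₗ[S] A1),
    IsMFMorphism dB0 dB1 dA0 dA1 g0 g1 ∧
    MFHomotopic dA0 dA1 dA0 dA1 (g0.comp f0) LinearMap.id (g1.comp f1) LinearMap.id ∧
    MFHomotopic dB0 dB1 dB0 dB1 (f0.comp g0) LinearMap.id (f1.comp g1) LinearMap.id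

end MFdefs

variable (m N : ℕ)

/-- The grading of `R̃ = ℂ[X_1,…,X_m,B_1,…,B_N]`: `X_i` has degree `dX i` and `B_k` has
degree `2k`. -/
def wtF (dX : Fin m → ℕ) : (Fin m ⊕ Fin N) → ℤ :=
  Sum.elim (fun i => (dX i : ℤ)) (fun kk => 2 * ((kk : ℕ) + 1))

/-- The reduction `R̃ → R̃/I_B ≅ ℂ[X_1,…,X_m]` sending every `B_k` to `0`. -/
noncomputable def piB : MvPolynomial (Fin m ⊕ Fin N) ℂ →+* MvPolynomial (Fin m) ℂ :=
  (aeval (Sum.elim MvPolynomial.X (fun _ => (0 : MvPolynomial (Fin m) ℂ)))).toRingHom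

/-- The reduction modulo `I_B` of a linear map between graded free `R̃`-modules
(`M̃/I_B M̃ → M̃′/I_B M̃′`): reduce all matrix entries. -/
noncomputable def redMap {ι κ : Type*}
    (f : (ι →₀ MvPolynomial (Fin m ⊕ Fin N) ℂ) →ₗ[MvPolynomial (Fin m ⊕ Fin N) ℂ]
      (κ →₀ MvPolynomial (Fin m ⊕ Fin N) ℂ)) :
    (ι →₀ MvPolynomial (Fin m) ℂ) →ₗ[MvPolynomial (Fin m) ℂ]
      (κ →₀ MvPolynomial (Fin m) ℂ) :=
  Finsupp.lsum ℕ fun i => LinearMap.toSpanSingleton _ _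
    (Finsupp.mapRange (piB m N) (map_zero _) (f (Finsupp.single i 1)))

/-- A linear map between graded free modules (with basis degree functions `δι`, `δκ`) is
homogeneous of degree `c` iff each matrix entry is weighted homogeneous of the appropriate
degree. -/
def HomogMap {ι κ : Type*} (dX : Fin m → ℕ) (δι : ι → ℤ) (δκ : κ → ℤ) (c : ℤ)
    (f : (ι →₀ MvPolynomial (Fin m ⊕ Fin N) ℂ) →ₗ[MvPolynomial (Fin m ⊕ Fin N) ℂ]
      (κ →₀ MvPolynomial (Fin m ⊕ Fin N) ℂ)) : Prop :=
  ∀ (i : ι) (j : κ),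
    ((f (Finsupp.single i 1)) j).IsWeightedHomogeneous (wtF m N dX) (δι i + c - δκ j)

section NullHomotopy

variable {S : Type*} [CommRing S] {A0 A1 : Type*} [AddCommGroup A0] [AddCommGroup A1]
  [Module S A0] [Module S A1]

/-- If `d h + h d` is bijective on a matrix factorization, then the identity is homotopic to
zero: `d h + h d` commutes with `d`, so composing `h` with its inverse gives a contraction. -/
theorem mfHomotopic_id_zero_of_bijective {w : S} {d0 : A0 →ₗ[S] A1} {d1 : A1 →ₗ[S] A0}
    (hmf1 : d1.comp d0 = w • LinearMap.id) (hmf2 : d0.comp d1 = w • LinearMap.id)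
    {h0 : A0 →ₗ[S] A1} {h1 : A1 →ₗ[S] A0}
    (he0 : Function.Bijective (d1.comp h0 + h1.comp d0))
    (he1 : Function.Bijective (d0.comp h1 + h0.comp d1)) :
    MFHomotopic d0 d1 d0 d1 LinearMap.id 0 LinearMap.id 0 := by
  have hd10 (x : A0) : d1 (d0 x) = w • x := by simpa using LinearMap.congr_fun hmf1 x
  have hd01 (x : A1) : d0 (d1 x) = w • x := by simpa using LinearMap.congr_fun hmf2 x
  let e0 := LinearEquiv.ofBijective _ he0
  let e1 := LinearEquiv.ofBijective _ he1
  have he0_apply (x : A0) : e0 x = d1 (h0 x) + h1 (d0 x) := rfl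
  have he1_apply (x : A1) : e1 x = d0 (h1 x) + h0 (d1 x) := rfl
  have hcomm0 (x : A0) : e1.symm (d0 x) = d0 (e0.symm x) := by
    rw [LinearEquiv.symm_apply_eq, he1_apply, hd10, map_smul, ← hd01, add_comm, ← map_add,
      ← he0_apply, LinearEquiv.apply_symm_apply]
  have hcomm1 (x : A1) : e0.symm (d1 x) = d1 (e1.symm x) := by
    rw [LinearEquiv.symm_apply_eq, he0_apply, hd01, map_smul, ← hd10, add_comm, ← map_add,
      ← he1_apply, LinearEquiv.apply_symm_apply]
  refine ⟨h0.comp e0.symm.toLinearMap, h1.comp e1.symm.toLinearMap, ?_, ?_⟩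
  · ext x
    simp [hcomm0, ← he0_apply]
  · ext x
    simp [hcomm1, ← he1_apply]

/-- If `f` is locally nilpotent then `1 - f` is bijective. -/
theorem bijective_id_sub_of_locally_nilpotent (f : Module.End S A0)
    (hf : ∀ x, ∃ n : ℕ, (f ^ n) x = 0) : Function.Bijective ((1 : Module.End S A0) - f) := by
  constructor
  · rw [injective_iff_map_eq_zero]
    intro x hx
    obtain ⟨n, hn⟩ := hf x
    have hfix : f x = x := (sub_eq_zero.mp hx).symm
    rwa [Module.End.pow_apply, Function.iterate_fixed hfix] at hn
  · intro x
    obtain ⟨n, hn⟩ := hf x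
    refine ⟨(∑ i ∈ Finset.range n, f ^ i) x, ?_⟩
    rw [← Module.End.mul_apply, mul_neg_geom_sum, LinearMap.sub_apply, hn, sub_zero,
      Module.End.one_apply]

/-- An endomorphism of a free module which strictly lowers an integer degree, bounded below, of
the basis vectors is locally nilpotent. -/
theorem exists_pow_apply_eq_zero_of_degree_lt {ι : Type*} (δ : ι → ℤ) {c : ℤ} (hc : ∀ i, c ≤ δ i)
    (f : Module.End S (ι →₀ S))
    (hf : ∀ i j, f (Finsupp.single i 1) j ≠ 0 → δ j < δ i) (x : ι →₀ S) :
    ∃ n : ℕ, (f ^ n) x = 0 := by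
  have hbasis (n : ℕ) : ∀ i, δ i < c + n → (f ^ n) (Finsupp.single i 1) = 0 := by
    induction n with
    | zero => intro i hi; have := hc i; simp at hi; omega
    | succ n ih =>
      intro i hi
      rw [pow_succ, Module.End.mul_apply, ← Finsupp.sum_single (f (Finsupp.single i 1)),
        Finsupp.sum, map_sum]
      refine Finset.sum_eq_zero fun j hj => ?_
      have := hf i j (Finsupp.mem_support_iff.mp hj)
      rw [← mul_one (f (Finsupp.single i 1) j), ← smul_eq_mul, ← Finsupp.smul_single, map_smul,
        ih j (by push_cast at hi; omega), smul_zero]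
  induction x using Finsupp.induction_linear with
  | zero => exact ⟨0, by simp⟩
  | add x y hx hy =>
    obtain ⟨a, ha⟩ := hx
    obtain ⟨b, hb⟩ := hy
    refine ⟨a + b, ?_⟩
    rw [map_add, add_comm a b, pow_add, Module.End.mul_apply, ha, map_zero, ← pow_add,
      add_comm b a, pow_add, Module.End.mul_apply, hb, map_zero, add_zero]
  | single i r =>
    refine ⟨(δ i + 1 - c).toNat, ?_⟩
    rw [← mul_one r, ← smul_eq_mul, ← Finsupp.smul_single, map_smul,
      hbasis _ i (by have := hc i; omega), smul_zero]

end NullHomotopy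

section HomogeneousPart

variable {σ R : Type*} [CommRing R] (u : σ → ℤ)

theorem weightedHomogeneousComponent_mul_of_left {p : MvPolynomial σ R} {a : ℤ}
    (hp : p.IsWeightedHomogeneous u a) (n : ℤ) (q : MvPolynomial σ R) :
    weightedHomogeneousComponent u (n + a) (p * q) =
      p * weightedHomogeneousComponent u n q := by
  classical
  ext d
  rw [coeff_weightedHomogeneousComponent, coeff_mul, coeff_mul, Finset.ite_sum_zero]
  refine Finset.sum_congr rfl fun x hx => ?_
  rw [Finset.HasAntidiagonal.mem_antidiagonal] at hx
  by_cases hx1 : coeff x.1 p = 0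
  · simp [hx1]
  · have hwt : Finsupp.weight u d = a + Finsupp.weight u x.2 := by
      rw [← hx, map_add, hp hx1]
    rw [coeff_weightedHomogeneousComponent, mul_ite, mul_zero, hwt]
    exact if_congr (by constructor <;> intro h <;> omega) rfl rfl

/-- The homogeneous component of degree `n` in the free graded module whose basis has
degrees `δ`. -/
noncomputable def gradedComponent {κ : Type*} (δ : κ → ℤ) (n : ℤ) :
    (κ →₀ MvPolynomial σ R) →ₗ[R] (κ →₀ MvPolynomial σ R) :=
  Finsupp.lsum ℕ fun j =>
    Finsupp.lsingle j ∘ₗ weightedHomogeneousComponent u (n - δ j)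

variable {ι κ τ : Type*} (δι : ι → ℤ) (δκ : κ → ℤ) (δτ : τ → ℤ)

theorem gradedComponent_single (n : ℤ) (j : κ) (p : MvPolynomial σ R) :
    gradedComponent u δκ n (Finsupp.single j p) =
      Finsupp.single j (weightedHomogeneousComponent u (n - δκ j) p) := by
  simp [gradedComponent]

theorem gradedComponent_apply (n : ℤ) (v : κ →₀ MvPolynomial σ R) (j : κ) :
    gradedComponent u δκ n v j = weightedHomogeneousComponent u (n - δκ j) (v j) := by
  classical
  induction v using Finsupp.induction_linear with
  | zero => simp
  | add x y hx hy => simp [hx, hy]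
  | single i p =>
    rw [gradedComponent_single, Finsupp.single_apply, Finsupp.single_apply]
    split_ifs with h
    · rw [h]
    · rw [map_zero]

theorem gradedComponent_smul {p : MvPolynomial σ R} {a : ℤ} (hp : p.IsWeightedHomogeneous u a)
    (n : ℤ) (v : κ →₀ MvPolynomial σ R) :
    gradedComponent u δκ (n + a) (p • v) = p • gradedComponent u δκ n v := by
  ext1 j
  rw [gradedComponent_apply, Finsupp.smul_apply, Finsupp.smul_apply, gradedComponent_apply,
    smul_eq_mul, smul_eq_mul, ← weightedHomogeneousComponent_mul_of_left u hp]
  congr 2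
  ring

theorem gradedComponent_smul_of_homogeneous {v : κ →₀ MvPolynomial σ R} {a : ℤ}
    (hv : ∀ j, (v j).IsWeightedHomogeneous u (a - δκ j)) (n : ℤ) (p : MvPolynomial σ R) :
    gradedComponent u δκ (n + a) (p • v) = weightedHomogeneousComponent u n p • v := by
  ext1 j
  rw [gradedComponent_apply, Finsupp.smul_apply, Finsupp.smul_apply, smul_eq_mul, smul_eq_mul,
    mul_comm p, mul_comm _ (v j), ← weightedHomogeneousComponent_mul_of_left u (hv j)]
  congr 2
  ring

/-- The homogeneous part of degree `c` of a linear map between free graded modules. -/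
noncomputable def homogeneousPart (c : ℤ)
    (f : (ι →₀ MvPolynomial σ R) →ₗ[MvPolynomial σ R] (κ →₀ MvPolynomial σ R)) :
    (ι →₀ MvPolynomial σ R) →ₗ[MvPolynomial σ R] (κ →₀ MvPolynomial σ R) :=
  Finsupp.linearCombination _ fun i => gradedComponent u δκ (δι i + c) (f (Finsupp.single i 1))

theorem homogeneousPart_single (c : ℤ)
    (f : (ι →₀ MvPolynomial σ R) →ₗ[MvPolynomial σ R] (κ →₀ MvPolynomial σ R))
    (i : ι) (p : MvPolynomial σ R) :
    homogeneousPart u δι δκ c f (Finsupp.single i p) =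
      p • gradedComponent u δκ (δι i + c) (f (Finsupp.single i 1)) :=
  Finsupp.linearCombination_single _ _ _

theorem map_single_eq_smul {S A : Type*} [CommRing S] [AddCommGroup A] [Module S A]
    (f : (ι →₀ S) →ₗ[S] A) (i : ι) (p : S) :
    f (Finsupp.single i p) = p • f (Finsupp.single i 1) := by
  rw [← map_smul, Finsupp.smul_single, smul_eq_mul, mul_one]

theorem gradedComponent_map_of_homogeneous {a : ℤ}
    {g : (ι →₀ MvPolynomial σ R) →ₗ[MvPolynomial σ R] (κ →₀ MvPolynomial σ R)}
    (hg : ∀ i j, (g (Finsupp.single i 1) j).IsWeightedHomogeneous u (δι i + a - δκ j))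
    (n : ℤ) (v : ι →₀ MvPolynomial σ R) :
    gradedComponent u δκ (n + a) (g v) = g (gradedComponent u δι n v) := by
  induction v using Finsupp.induction_linear with
  | zero => simp
  | add x y hx hy => simp [hx, hy]
  | single i p =>
    rw [gradedComponent_single, map_single_eq_smul g i p,
      map_single_eq_smul g i (weightedHomogeneousComponent _ _ _),
      ← gradedComponent_smul_of_homogeneous u δκ (hg i)]
    congr 2
    ring

theorem gradedComponent_map_homogeneous (c n : ℤ)
    (f : (ι →₀ MvPolynomial σ R) →ₗ[MvPolynomial σ R] (κ →₀ MvPolynomial σ R))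
    {v : ι →₀ MvPolynomial σ R} (hv : ∀ i, (v i).IsWeightedHomogeneous u (n - δι i)) :
    gradedComponent u δκ (n + c) (f v) = homogeneousPart u δι δκ c f v := by
  rw [← Finsupp.sum_single v, Finsupp.sum, map_sum, map_sum, map_sum]
  refine Finset.sum_congr rfl fun i _ => ?_
  rw [homogeneousPart_single, map_single_eq_smul f i, ← gradedComponent_smul u δκ (hv i)]
  congr 2
  ring

theorem homogeneousPart_comp_left {a : ℤ}
    {g : (κ →₀ MvPolynomial σ R) →ₗ[MvPolynomial σ R] (τ →₀ MvPolynomial σ R)}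
    (hg : ∀ i j, (g (Finsupp.single i 1) j).IsWeightedHomogeneous u (δκ i + a - δτ j)) (c : ℤ)
    (f : (ι →₀ MvPolynomial σ R) →ₗ[MvPolynomial σ R] (κ →₀ MvPolynomial σ R)) :
    homogeneousPart u δι δτ (c + a) (g.comp f) = g.comp (homogeneousPart u δι δκ c f) := by
  refine Finsupp.lhom_ext fun i p => ?_
  rw [homogeneousPart_single, LinearMap.comp_apply, LinearMap.comp_apply, homogeneousPart_single,
    map_smul, ← gradedComponent_map_of_homogeneous u δκ δτ hg, add_assoc]

theorem homogeneousPart_comp_right {a : ℤ}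
    {g : (ι →₀ MvPolynomial σ R) →ₗ[MvPolynomial σ R] (κ →₀ MvPolynomial σ R)}
    (hg : ∀ i j, (g (Finsupp.single i 1) j).IsWeightedHomogeneous u (δι i + a - δκ j)) (c : ℤ)
    (f : (κ →₀ MvPolynomial σ R) →ₗ[MvPolynomial σ R] (τ →₀ MvPolynomial σ R)) :
    homogeneousPart u δι δτ (c + a) (f.comp g) = (homogeneousPart u δκ δτ c f).comp g := by
  refine Finsupp.lhom_ext fun i p => ?_
  rw [homogeneousPart_single, LinearMap.comp_apply, LinearMap.comp_apply, map_single_eq_smul g i p,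
    map_smul, ← gradedComponent_map_homogeneous u δκ δτ c (δι i + a) f (hg i), add_comm c,
    add_assoc]

theorem homogeneousPart_add (c : ℤ)
    (f g : (ι →₀ MvPolynomial σ R) →ₗ[MvPolynomial σ R] (κ →₀ MvPolynomial σ R)) :
    homogeneousPart u δι δκ c (f + g) =
      homogeneousPart u δι δκ c f + homogeneousPart u δι δκ c g := by
  refine Finsupp.lhom_ext fun i p => ?_
  simp [homogeneousPart_single]

theorem homogeneousPart_sub (c : ℤ)
    (f g : (ι →₀ MvPolynomial σ R) →ₗ[MvPolynomial σ R] (κ →₀ MvPolynomial σ R)) :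
    homogeneousPart u δι δκ c (f - g) =
      homogeneousPart u δι δκ c f - homogeneousPart u δι δκ c g := by
  refine Finsupp.lhom_ext fun i p => ?_
  simp [homogeneousPart_single, smul_sub]

theorem homogeneousPart_one :
    homogeneousPart u δι δι 0 (1 : Module.End (MvPolynomial σ R) (ι →₀ MvPolynomial σ R)) = 1 := by
  refine Finsupp.lhom_ext fun i p => ?_
  rw [homogeneousPart_single, Module.End.one_apply, gradedComponent_single, add_zero, sub_self,
    (isWeightedHomogeneous_one R u).weightedHomogeneousComponent_same, Finsupp.smul_single,
    smul_eq_mul, mul_one, Module.End.one_apply]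

end HomogeneousPart

section Reduction

variable {m N} {ι κ τ : Type*}

theorem piB_rename_inl (p : MvPolynomial (Fin m) ℂ) : piB m N (rename Sum.inl p) = p := by
  change aeval _ (rename Sum.inl p) = p
  rw [aeval_rename, Sum.elim_comp_inl, aeval_X_left_apply]

/-- Every monomial of a polynomial in the kernel of the reduction involves some `B_k`. -/
theorem exists_inr_ne_zero_of_piB_eq_zero {p : MvPolynomial (Fin m ⊕ Fin N) ℂ}
    (hp : piB m N p = 0) {s : Fin m ⊕ Fin N →₀ ℕ} (hs : coeff s p ≠ 0) :
    ∃ k : Fin N, s (Sum.inr k) ≠ 0 := by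
  let I : Ideal (MvPolynomial (Fin m ⊕ Fin N) ℂ) := Ideal.span (X '' Set.range Sum.inr)
  have hsec : (Ideal.Quotient.mkₐ ℂ I).comp ((rename Sum.inl).comp
      (aeval (Sum.elim X fun _ => (0 : MvPolynomial (Fin m) ℂ)))) = Ideal.Quotient.mkₐ ℂ I := by
    ext x
    rcases x with i | k
    · simp
    · have : (X (Sum.inr k) : MvPolynomial (Fin m ⊕ Fin N) ℂ) ∈ I :=
        Ideal.subset_span ⟨_, ⟨k, rfl⟩, rfl⟩
      simpa using (Ideal.Quotient.eq_zero_iff_mem.mpr this).symm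
  have hpI : p ∈ I := by
    rw [← Ideal.Quotient.eq_zero_iff_mem]
    have hsec_p := AlgHom.congr_fun hsec p
    have hp' : aeval (Sum.elim X fun _ => (0 : MvPolynomial (Fin m) ℂ)) p = 0 := hp
    rw [AlgHom.comp_apply, AlgHom.comp_apply, hp', map_zero, map_zero] at hsec_p
    exact hsec_p.symm
  obtain ⟨_, ⟨k, rfl⟩, hk⟩ := mem_ideal_span_X_image.mp hpI s (mem_support_iff.mpr hs)
  exact ⟨k, hk⟩

theorem weight_wtF_pos (dX : Fin m → ℕ) {s : Fin m ⊕ Fin N →₀ ℕ} {k : Fin N}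
    (hk : s (Sum.inr k) ≠ 0) : 0 < Finsupp.weight (wtF m N dX) s := by
  have hnonneg (x : Fin m ⊕ Fin N) : 0 ≤ wtF m N dX x := by
    rcases x with i | k
    · simp [wtF]
    · simp only [wtF, Sum.elim_inr]; positivity
  refine lt_of_lt_of_le ?_ (Finsupp.le_weight_of_ne_zero hnonneg hk)
  simp only [wtF, Sum.elim_inr]
  positivity

theorem redMap_single
    (f : (ι →₀ MvPolynomial (Fin m ⊕ Fin N) ℂ) →ₗ[MvPolynomial (Fin m ⊕ Fin N) ℂ]
      (κ →₀ MvPolynomial (Fin m ⊕ Fin N) ℂ)) (i : ι) (p : MvPolynomial (Fin m) ℂ) :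
    redMap m N f (Finsupp.single i p) =
      p • Finsupp.mapRange (piB m N) (map_zero _) (f (Finsupp.single i 1)) := by
  simp [redMap]

theorem redMap_mapRange
    (f : (ι →₀ MvPolynomial (Fin m ⊕ Fin N) ℂ) →ₗ[MvPolynomial (Fin m ⊕ Fin N) ℂ]
      (κ →₀ MvPolynomial (Fin m ⊕ Fin N) ℂ)) (v : ι →₀ MvPolynomial (Fin m ⊕ Fin N) ℂ) :
    redMap m N f (Finsupp.mapRange (piB m N) (map_zero _) v) =
      Finsupp.mapRange (piB m N) (map_zero _) (f v) := by
  induction v using Finsupp.induction_linear with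
  | zero => simp
  | add x y hx hy =>
    rw [Finsupp.mapRange_add (map_add (piB m N)), map_add, map_add,
      Finsupp.mapRange_add (map_add (piB m N)), hx, hy]
  | single i p =>
    rw [Finsupp.mapRange_single, redMap_single, map_single_eq_smul f i p]
    ext1 j
    simp

theorem redMap_comp
    (g : (κ →₀ MvPolynomial (Fin m ⊕ Fin N) ℂ) →ₗ[MvPolynomial (Fin m ⊕ Fin N) ℂ]
      (τ →₀ MvPolynomial (Fin m ⊕ Fin N) ℂ))
    (f : (ι →₀ MvPolynomial (Fin m ⊕ Fin N) ℂ) →ₗ[MvPolynomial (Fin m ⊕ Fin N) ℂ]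
      (κ →₀ MvPolynomial (Fin m ⊕ Fin N) ℂ)) :
    redMap m N (g.comp f) = (redMap m N g).comp (redMap m N f) := by
  refine Finsupp.lhom_ext fun i p => ?_
  rw [LinearMap.comp_apply, redMap_single, redMap_single, map_smul, redMap_mapRange,
    LinearMap.comp_apply]

theorem redMap_add
    (f g : (ι →₀ MvPolynomial (Fin m ⊕ Fin N) ℂ) →ₗ[MvPolynomial (Fin m ⊕ Fin N) ℂ]
      (κ →₀ MvPolynomial (Fin m ⊕ Fin N) ℂ)) :
    redMap m N (f + g) = redMap m N f + redMap m N g := by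
  refine Finsupp.lhom_ext fun i p => ?_
  rw [LinearMap.add_apply, redMap_single, redMap_single, redMap_single, LinearMap.add_apply,
    Finsupp.mapRange_add (map_add (piB m N)), smul_add]

theorem redMap_id : redMap m N (LinearMap.id : (ι →₀ MvPolynomial (Fin m ⊕ Fin N) ℂ) →ₗ[_] _) =
    LinearMap.id := by
  refine Finsupp.lhom_ext fun i p => ?_
  rw [redMap_single]
  simp

theorem redMap_surjective : Function.Surjective (redMap m N : (_ →ₗ[_] _) →
    (ι →₀ MvPolynomial (Fin m) ℂ) →ₗ[MvPolynomial (Fin m) ℂ] (κ →₀ MvPolynomial (Fin m) ℂ)) := by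
  intro h
  refine ⟨Finsupp.linearCombination _ fun i =>
    Finsupp.mapRange (rename Sum.inl) (map_zero _) (h (Finsupp.single i 1)), ?_⟩
  refine Finsupp.lhom_ext fun i p => ?_
  rw [redMap_single, map_single_eq_smul h i p, Finsupp.linearCombination_single, one_smul]
  congr 1
  ext1 j
  simp [piB_rename_inl]

/-- If `f` reduces to the identity modulo `I_B` then its degree zero part is bijective, provided
the grading is bounded below. -/
theorem bijective_homogeneousPart_of_redMap_eq_id (dX : Fin m → ℕ) (δ : ι → ℤ) {c : ℤ}
    (hc : ∀ i, c ≤ δ i)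
    (f : Module.End (MvPolynomial (Fin m ⊕ Fin N) ℂ) (ι →₀ MvPolynomial (Fin m ⊕ Fin N) ℂ))
    (hf : redMap m N f = LinearMap.id) :
    Function.Bijective (homogeneousPart (wtF m N dX) δ δ 0 f) := by
  classical
  have hsub : homogeneousPart (wtF m N dX) δ δ 0 f =
      1 - homogeneousPart (wtF m N dX) δ δ 0 (1 - f) := by
    rw [homogeneousPart_sub, homogeneousPart_one]
    exact LinearMap.ext fun v => (sub_sub_cancel v _).symm
  rw [hsub]
  refine bijective_id_sub_of_locally_nilpotent _
    (exists_pow_apply_eq_zero_of_degree_lt δ hc _ fun i j hij => ?_)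
  rw [homogeneousPart_single, one_smul, gradedComponent_apply, ne_zero_iff] at hij
  obtain ⟨s, hs⟩ := hij
  rw [coeff_weightedHomogeneousComponent, ite_ne_right_iff] at hs
  have hker : piB m N ((1 - f) (Finsupp.single i 1) j) = 0 := by
    have hij := DFunLike.congr_fun (LinearMap.congr_fun hf (Finsupp.single i 1)) j
    rw [redMap_single, one_smul, Finsupp.mapRange_apply, LinearMap.id_apply] at hij
    rw [LinearMap.sub_apply, Finsupp.sub_apply, map_sub, hij, Module.End.one_apply,
      Finsupp.single_apply, Finsupp.single_apply]
    split_ifs <;> simp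
  obtain ⟨k, hk⟩ := exists_inr_ne_zero_of_piB_eq_zero hker hs.2
  have := weight_wtF_pos dX hk
  omega

/-- A homogeneous part of a homotopy which contracts a graded matrix factorization modulo `I_B`
gives a bijection `d h + h d`. -/
theorem bijective_homotopy_of_redMap (dX : Fin m → ℕ) (δι : ι → ℤ) (δκ : κ → ℤ) {c a : ℤ}
    (hc : ∀ i, c ≤ δι i)
    {d0 : (ι →₀ MvPolynomial (Fin m ⊕ Fin N) ℂ) →ₗ[MvPolynomial (Fin m ⊕ Fin N) ℂ]
      (κ →₀ MvPolynomial (Fin m ⊕ Fin N) ℂ)}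
    {d1 : (κ →₀ MvPolynomial (Fin m ⊕ Fin N) ℂ) →ₗ[MvPolynomial (Fin m ⊕ Fin N) ℂ]
      (ι →₀ MvPolynomial (Fin m ⊕ Fin N) ℂ)}
    (hd0 : HomogMap m N dX δι δκ a d0) (hd1 : HomogMap m N dX δκ δι a d1)
    (h0 : (ι →₀ MvPolynomial (Fin m ⊕ Fin N) ℂ) →ₗ[MvPolynomial (Fin m ⊕ Fin N) ℂ]
      (κ →₀ MvPolynomial (Fin m ⊕ Fin N) ℂ))
    (h1 : (κ →₀ MvPolynomial (Fin m ⊕ Fin N) ℂ) →ₗ[MvPolynomial (Fin m ⊕ Fin N) ℂ]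
      (ι →₀ MvPolynomial (Fin m ⊕ Fin N) ℂ))
    (hred : LinearMap.id =
      (redMap m N d1).comp (redMap m N h0) + (redMap m N h1).comp (redMap m N d0)) :
    Function.Bijective (d1.comp (homogeneousPart (wtF m N dX) δι δκ (-a) h0) +
      (homogeneousPart (wtF m N dX) δκ δι (-a) h1).comp d0) := by
  rw [← homogeneousPart_comp_left _ δι δκ δι hd1, ← homogeneousPart_comp_right _ δι δκ δι hd0,
    ← homogeneousPart_add, neg_add_cancel]
  refine bijective_homogeneousPart_of_redMap_eq_id dX δι hc _ ?_
  rw [redMap_add, redMap_comp, redMap_comp, ← hred]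

end Reduction

theorem null_homotopic_iff_reduction (hN : 2 ≤ N)
    (dX : Fin m → ℕ) (hdX : ∀ i, 0 < dX i)
    (w : MvPolynomial (Fin m ⊕ Fin N) ℂ)
    (hw : w.IsWeightedHomogeneous (wtF m N dX) (2 * (N : ℤ) + 2))
    {ι₀ ι₁ : Type*}
    (δι₀ : ι₀ → ℤ) (δι₁ : ι₁ → ℤ)
    (hbdd : ∃ c : ℤ, (∀ i, c ≤ δι₀ i) ∧ (∀ i, c ≤ δι₁ i))
    (d0 : (ι₀ →₀ MvPolynomial (Fin m ⊕ Fin N) ℂ) →ₗ[MvPolynomial (Fin m ⊕ Fin N) ℂ]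
      (ι₁ →₀ MvPolynomial (Fin m ⊕ Fin N) ℂ))
    (d1 : (ι₁ →₀ MvPolynomial (Fin m ⊕ Fin N) ℂ) →ₗ[MvPolynomial (Fin m ⊕ Fin N) ℂ]
      (ι₀ →₀ MvPolynomial (Fin m ⊕ Fin N) ℂ))
    (hmf1 : d1.comp d0 = w • LinearMap.id) (hmf2 : d0.comp d1 = w • LinearMap.id)
    (hd0 : HomogMap m N dX δι₀ δι₁ ((N : ℤ) + 1) d0)
    (hd1 : HomogMap m N dX δι₁ δι₀ ((N : ℤ) + 1) d1) :
    MFHomotopic d0 d1 d0 d1 LinearMap.id 0 LinearMap.id 0 ↔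
      MFHomotopic (redMap m N d0) (redMap m N d1) (redMap m N d0) (redMap m N d1)
        LinearMap.id 0 LinearMap.id 0 := by
  constructor
  · rintro ⟨h0, h1, hh0, hh1⟩
    refine ⟨redMap m N h0, redMap m N h1, ?_, ?_⟩
    · rw [← redMap_comp, ← redMap_comp, ← redMap_add, ← hh0]
      exact (sub_zero _).trans (redMap_id.symm.trans (congrArg _ (sub_zero _).symm))
    · rw [← redMap_comp, ← redMap_comp, ← redMap_add, ← hh1]
      exact (sub_zero _).trans (redMap_id.symm.trans (congrArg _ (sub_zero _).symm))
  · rintro ⟨h0, h1, hh0, hh1⟩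
    obtain ⟨c, hc0, hc1⟩ := hbdd
    obtain ⟨h0, rfl⟩ := redMap_surjective (N := N) h0
    obtain ⟨h1, rfl⟩ := redMap_surjective (N := N) h1
    exact mfHomotopic_id_zero_of_bijective hmf1 hmf2
      (bijective_homotopy_of_redMap dX δι₀ δι₁ hc0 hd0 hd1 h0 h1 ((sub_zero _).symm.trans hh0))
      (bijective_homotopy_of_redMap dX δι₁ δι₀ hc1 hd1 hd0 h1 h0 ((sub_zero _).symm.trans hh1))
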